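/- Let m be a nonzero integer, let E be the elliptic curve y^2 = x^3 - 432m^2 over ℚ, let p be a prime with p > 3, and let Q ∈ E(ℚ) be a point of infinite order with ord_p(x(Q)) < 0. Then for every integer k ≥ 1, ord_p(x(kQ)) = ord_p(x(Q)) - 2·ord_p(k). -/

import Mathlib

open WeierstrassCurve

/-- The Mordell curve `y² = x³ - 432·m²` as an affine Weierstrass curve over `ℚ`. -/
noncomputable def Mordell (m : ℤ) : WeierstrassCurve.Affine ℚ :=
  { a₁ := 0, a₂ := 0, a₃ := 0, a₄ := 0, a₆ := -432 * (m : ℚ) ^ 2 }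

/-- An integer is cube-free if the only cubes dividing it are units. -/
def CubeFree (m : ℤ) : Prop := ∀ d : ℤ, d ^ 3 ∣ m → IsUnit d

/-- `d` is a primitive divisor of the `n`-th term of the sequence `S`: `d > 1`, `d ∣ S n`,
and `d` is coprime to every earlier nonzero term. -/
def IsPrimitiveDivisor (S : ℕ → ℤ) (n : ℕ) (d : ℤ) : Prop :=
  1 < d ∧ d ∣ S n ∧ ∀ k : ℕ, 1 ≤ k → k < n → S k ≠ 0 → Int.gcd d (S k) = 1

/-- The x-coordinate of an affine point (junk value `0` at the point at infinity). -/
noncomputable def xCoord {m : ℤ} : (Mordell m).Point → ℚ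
  | .zero => 0
  | @WeierstrassCurve.Affine.Point.some _ _ _ x _ _ => x

/-- The ultrametric inequality for the `p`-adic norm, with an explicit bound. -/
lemma padicNorm_add_le {p : ℕ} [Fact p.Prime] {a b r : ℚ}
    (ha : padicNorm p a ≤ r) (hb : padicNorm p b ≤ r) : padicNorm p (a + b) ≤ r :=
  padicNorm.nonarchimedean.trans (max_le ha hb)

lemma padicNorm_mul_le {p : ℕ} [Fact p.Prime] {a b r s : ℚ}
    (ha : padicNorm p a ≤ r) (hb : padicNorm p b ≤ s) : padicNorm p (a * b) ≤ r * s := by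
  rw [padicNorm.mul]
  exact mul_le_mul ha hb (padicNorm.nonneg _) ((padicNorm.nonneg _).trans ha)

lemma padicNorm_pow {p : ℕ} [Fact p.Prime] (a : ℚ) (n : ℕ) :
    padicNorm p (a ^ n) = padicNorm p a ^ n := by
  induction n with
  | zero => simp
  | succ n ih => rw [pow_succ, padicNorm.mul, ih, pow_succ]

lemma padicNorm_add_eq_left {p : ℕ} [Fact p.Prime] {a b : ℚ}
    (h : padicNorm p b < padicNorm p a) : padicNorm p (a + b) = padicNorm p a := by
  rw [padicNorm.add_eq_max_of_ne h.ne', max_eq_left h.le]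

/-- If the line `y = ℓ x + c` meets `y² = x³ + B` in two points near infinity, given in the
coordinates `z = x / y`, `w = 1 / y`, then its slope `-ℓ / c` and intercept `1 / c` in these
coordinates are small. -/
lemma line_near_infinity {p : ℕ} [Fact p.Prime] {B ρ x₁ y₁ x₂ y₂ ℓ c : ℚ}
    (hB : padicNorm p B ≤ 1) (hρ : ρ < 1)
    (hy₁ : y₁ ≠ 0) (hy₂ : y₂ ≠ 0)
    (hz₁ : padicNorm p (x₁ / y₁) ≤ ρ) (hz₂ : padicNorm p (x₂ / y₂) ≤ ρ)
    (hw₁ : padicNorm p (1 / y₁) ≤ ρ ^ 3) (hw₂ : padicNorm p (1 / y₂) ≤ ρ ^ 3)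
    (hc₁ : y₁ ^ 2 = x₁ ^ 3 + B) (hl₁ : y₁ = ℓ * x₁ + c) (hl₂ : y₂ = ℓ * x₂ + c)
    (hR : ℓ ^ 2 * (x₁ + x₂) + 2 * ℓ * c = x₁ ^ 2 + x₁ * x₂ + x₂ ^ 2) :
    c ≠ 0 ∧ padicNorm p (-ℓ / c) ≤ ρ ^ 2 ∧ padicNorm p (1 / c) ≤ ρ ^ 3 := by
  have hρ0 : 0 ≤ ρ := (padicNorm.nonneg _).trans hz₁
  set z₁ := x₁ / y₁ with hz₁d
  set z₂ := x₂ / y₂ with hz₂d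
  set w₁ := 1 / y₁ with hw₁d
  set w₂ := 1 / y₂ with hw₂d
  have key : -ℓ * (1 + -B * (w₁ ^ 2 + w₁ * w₂ + w₂ ^ 2)) =
      c * (z₁ ^ 2 + z₁ * z₂ + z₂ ^ 2) := by
    have h : -ℓ * (y₁ ^ 2 * y₂ ^ 2 - B * (y₁ ^ 2 + y₁ * y₂ + y₂ ^ 2)) =
        c * (x₁ ^ 2 * y₂ ^ 2 + x₁ * x₂ * y₁ * y₂ + x₂ ^ 2 * y₁ ^ 2) := by
      have hB' : B = y₁ ^ 2 - x₁ ^ 3 := by linear_combination -hc₁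
      rw [hB', hl₂, hl₁]
      linear_combination (ℓ * x₁ + c) ^ 3 * hR
    rw [hz₁d, hz₂d, hw₁d, hw₂d]
    field_simp
    linear_combination h
  have hW : padicNorm p (-B * (w₁ ^ 2 + w₁ * w₂ + w₂ ^ 2)) < 1 := by
    have h : padicNorm p (w₁ ^ 2 + w₁ * w₂ + w₂ ^ 2) ≤ ρ ^ 3 * ρ ^ 3 := by
      rw [sq, sq]
      exact padicNorm_add_le (padicNorm_add_le (padicNorm_mul_le hw₁ hw₁)
        (padicNorm_mul_le hw₁ hw₂)) (padicNorm_mul_le hw₂ hw₂)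
    refine (padicNorm_mul_le ((padicNorm.neg B).trans_le hB) h).trans_lt ?_
    rw [one_mul, ← pow_add]
    exact pow_lt_one₀ hρ0 hρ (by norm_num)
  have hD : padicNorm p (1 + -B * (w₁ ^ 2 + w₁ * w₂ + w₂ ^ 2)) = 1 := by
    rw [padicNorm_add_eq_left (by rwa [padicNorm.one]), padicNorm.one]
  have hZ : padicNorm p (z₁ ^ 2 + z₁ * z₂ + z₂ ^ 2) ≤ ρ ^ 2 := by
    rw [sq, sq, sq]
    exact padicNorm_add_le (padicNorm_add_le (padicNorm_mul_le hz₁ hz₁)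
      (padicNorm_mul_le hz₁ hz₂)) (padicNorm_mul_le hz₂ hz₂)
  have hc : c ≠ 0 := by
    rintro rfl
    rw [zero_mul, mul_eq_zero, neg_eq_zero] at key
    rcases key with h | h
    · exact hy₁ (by rw [hl₁, h]; ring)
    · rw [h, padicNorm.zero] at hD
      exact zero_ne_one hD
  have hlam : padicNorm p (-ℓ / c) ≤ ρ ^ 2 := by
    have h := congrArg (padicNorm p) key
    rw [padicNorm.mul, hD, mul_one, padicNorm.mul] at h
    have hc' : padicNorm p c ≠ 0 := padicNorm.nonzero hc
    rwa [padicNorm.div, h, mul_div_cancel_left₀ _ hc']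
  refine ⟨hc, hlam, ?_⟩
  have h : 1 / c = w₁ + -(-ℓ / c * z₁) := by
    rw [hw₁d, hz₁d]
    field_simp
    linear_combination hl₁
  rw [h]
  refine padicNorm_add_le hw₁ ?_
  rw [padicNorm.neg]
  exact (padicNorm_mul_le hlam hz₁).trans_eq (by ring)

/-- The parameter `z = x / y` is additive to seventh order on collinear triples of points near
infinity on `y² = x³ + B`. -/
lemma third_point_near_infinity {p : ℕ} [Fact p.Prime] {B ρ x₁ y₁ x₂ y₂ ℓ c : ℚ}
    (hB : padicNorm p B ≤ 1) (hρ : ρ < 1)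
    (hy₁ : y₁ ≠ 0) (hy₂ : y₂ ≠ 0)
    (hz₁ : padicNorm p (x₁ / y₁) ≤ ρ) (hz₂ : padicNorm p (x₂ / y₂) ≤ ρ)
    (hw₁ : padicNorm p (1 / y₁) ≤ ρ ^ 3) (hw₂ : padicNorm p (1 / y₂) ≤ ρ ^ 3)
    (hc₁ : y₁ ^ 2 = x₁ ^ 3 + B) (hl₁ : y₁ = ℓ * x₁ + c) (hl₂ : y₂ = ℓ * x₂ + c)
    (hR : ℓ ^ 2 * (x₁ + x₂) + 2 * ℓ * c = x₁ ^ 2 + x₁ * x₂ + x₂ ^ 2)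
    {x₃ y₃ : ℚ} (hx₃ : x₃ = ℓ ^ 2 - x₁ - x₂) (hl₃ : y₃ = ℓ * x₃ + c) :
    y₃ ≠ 0 ∧ padicNorm p (x₃ / y₃) ≤ ρ ∧ padicNorm p (1 / y₃) ≤ ρ ^ 3 ∧
      padicNorm p (x₁ / y₁ + x₂ / y₂ + x₃ / y₃) ≤ ρ ^ 7 := by
  have hρ0 : 0 ≤ ρ := (padicNorm.nonneg _).trans hz₁
  obtain ⟨hc, hlam, hnu⟩ :=
    line_near_infinity hB hρ hy₁ hy₂ hz₁ hz₂ hw₁ hw₂ hc₁ hl₁ hl₂ hR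
  have e₂ : x₁ * x₂ + (x₁ + x₂) * x₃ = -2 * ℓ * c := by
    rw [hx₃]; linear_combination hR
  have e₃ : x₁ * x₂ * x₃ = c ^ 2 - B := by
    rw [hl₁] at hc₁
    linear_combination x₁ * e₂ - x₁ ^ 2 * hx₃ - hc₁
  have hB3 : padicNorm p (B * (-ℓ / c) ^ 3) < 1 := by
    rw [padicNorm.mul, padicNorm_pow]
    calc _ ≤ 1 * (ρ ^ 2) ^ 3 :=
          mul_le_mul hB (pow_le_pow_left₀ (padicNorm.nonneg _) hlam _)
            (pow_nonneg (padicNorm.nonneg _) _) zero_le_one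
      _ = ρ ^ 6 := by ring
      _ < 1 := pow_lt_one₀ hρ0 hρ (by norm_num)
  have hD : padicNorm p (1 + B * (-ℓ / c) ^ 3) = 1 := by
    rw [padicNorm_add_eq_left (by rwa [padicNorm.one]), padicNorm.one]
  have hD0 : 1 + B * (-ℓ / c) ^ 3 ≠ 0 := by
    intro h
    rw [h, padicNorm.zero] at hD
    exact zero_ne_one hD
  have prod : y₁ * y₂ * y₃ = c ^ 3 * (1 + B * (-ℓ / c) ^ 3) := by
    have h : c ^ 3 * (1 + B * (-ℓ / c) ^ 3) = c ^ 3 - B * ℓ ^ 3 := by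
      field_simp
      ring
    rw [h, hl₁, hl₂, hl₃]
    linear_combination ℓ ^ 3 * e₃ + ℓ ^ 2 * c * e₂ + ℓ * c ^ 2 * hx₃
  have hy₃ : y₃ ≠ 0 := right_ne_zero_of_mul (prod ▸ mul_ne_zero (pow_ne_zero 3 hc) hD0)
  have sum : x₁ / y₁ + x₂ / y₂ + x₃ / y₃ =
      -3 * B * (-ℓ / c) ^ 2 * (1 / c) / (1 + B * (-ℓ / c) ^ 3) := by
    have h₁ : x₁ / y₁ + x₂ / y₂ + x₃ / y₃ = -3 * B * ℓ ^ 2 / (y₁ * y₂ * y₃) := by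
      have h : x₁ * y₂ * y₃ + x₂ * y₁ * y₃ + x₃ * y₁ * y₂ = -3 * B * ℓ ^ 2 := by
        rw [hl₁, hl₂, hl₃]
        linear_combination 3 * ℓ ^ 2 * e₃ + 2 * ℓ * c * e₂ + c ^ 2 * hx₃
      rw [← h]
      field_simp
    rw [h₁, prod]
    generalize 1 + B * (-ℓ / c) ^ 3 = D at hD0
    field_simp
  have hsum : padicNorm p (x₁ / y₁ + x₂ / y₂ + x₃ / y₃) ≤ ρ ^ 7 := by
    rw [sum, padicNorm.div, hD, div_one]
    have h3 : padicNorm p (-3 : ℚ) ≤ 1 := mod_cast padicNorm.of_int (p := p) (-3)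
    have h := padicNorm_mul_le (padicNorm_mul_le (padicNorm_mul_le h3 hB)
      (padicNorm_mul_le hlam hlam)) hnu
    rw [← sq] at h
    exact h.trans_eq (by ring)
  have hz₃ : padicNorm p (x₃ / y₃) ≤ ρ := by
    have h : x₃ / y₃ = (x₁ / y₁ + x₂ / y₂ + x₃ / y₃) + (-(x₁ / y₁) + -(x₂ / y₂)) := by ring
    rw [h]
    refine padicNorm_add_le (hsum.trans (pow_le_of_le_one hρ0 hρ.le (by norm_num))) ?_
    exact padicNorm_add_le (by rwa [padicNorm.neg]) (by rwa [padicNorm.neg])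
  refine ⟨hy₃, hz₃, ?_, hsum⟩
  have h : 1 / y₃ = 1 / c + -ℓ / c * (x₃ / y₃) := by
    field_simp
    linear_combination -hl₃
  rw [h]
  exact padicNorm_add_le hnu ((padicNorm_mul_le hlam hz₃).trans_eq (by ring))

/-- `P` lies within `ρ` of the point at infinity for the parameter `z = x / y`, and `z(P)` agrees
with `t` up to `ρ ^ 7`. -/
def NearInfinity (p : ℕ) {m : ℤ} (ρ : ℚ) (P : (Mordell m).Point) (t : ℚ) : Prop :=
  ∃ x y h, P = .some x y h ∧ y ≠ 0 ∧ padicNorm p (x / y) ≤ ρ ∧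
    padicNorm p (1 / y) ≤ ρ ^ 3 ∧ padicNorm p (x / y - t) ≤ ρ ^ 7

lemma mordell_equation {m : ℤ} {x y : ℚ} (h : (Mordell m).Nonsingular x y) :
    y ^ 2 = x ^ 3 + -432 * (m : ℚ) ^ 2 := by
  simpa [Mordell] using ((Mordell m).equation_iff x y).mp h.1

lemma padicNorm_mordell_coeff (p : ℕ) [Fact p.Prime] (m : ℤ) :
    padicNorm p (-432 * (m : ℚ) ^ 2) ≤ 1 := by
  have h := padicNorm.of_int (p := p) (-432 * m ^ 2)
  push_cast at h
  exact h

lemma NearInfinity.add {p : ℕ} [Fact p.Prime] {m : ℤ} {ρ s t : ℚ} {P Q : (Mordell m).Point}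
    (hρ : ρ < 1) (hP : NearInfinity p ρ P s) (hQ : NearInfinity p ρ Q t) (hPQ : P + Q ≠ 0) :
    NearInfinity p ρ (P + Q) (s + t) := by
  obtain ⟨x₁, y₁, h₁, rfl, hy₁, hz₁, hw₁, hs⟩ := hP
  obtain ⟨x₂, y₂, h₂, rfl, hy₂, hz₂, hw₂, ht⟩ := hQ
  have hxy : ¬(x₁ = x₂ ∧ y₁ = (Mordell m).negY x₂ y₂) := fun h ↦
    hPQ (Affine.Point.add_of_Y_eq h.1 h.2)
  have hc₁ := mordell_equation h₁
  have hc₂ := mordell_equation h₂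
  set ℓ := (Mordell m).slope x₁ x₂ y₁ y₂ with hℓ
  have line : y₂ = ℓ * x₂ + (y₁ - ℓ * x₁) ∧
      ℓ ^ 2 * (x₁ + x₂) + 2 * ℓ * (y₁ - ℓ * x₁) = x₁ ^ 2 + x₁ * x₂ + x₂ ^ 2 := by
    by_cases hx : x₁ = x₂
    · have hy : y₁ ≠ (Mordell m).negY x₂ y₂ := fun h ↦ hxy ⟨hx, h⟩
      have hyy := Affine.Y_eq_of_Y_ne h₁.1 h₂.1 hx hy
      rw [Affine.slope_of_Y_ne hx hy] at hℓ
      subst hx hyy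
      have hℓ' : ℓ * (2 * y₁) = 3 * x₁ ^ 2 := by
        rw [hℓ]
        have h2 : 2 * y₁ ≠ 0 := mul_ne_zero two_ne_zero hy₁
        have hn : y₁ - (Mordell m).negY x₁ y₁ = 2 * y₁ := by
          simp only [Mordell, Affine.negY]
          ring
        rw [hn, div_mul_cancel₀ _ h2]
        simp [Mordell]
      exact ⟨by ring, by linear_combination hℓ'⟩
    · rw [Affine.slope_of_X_ne hx] at hℓ
      have hx' : x₁ - x₂ ≠ 0 := sub_ne_zero.mpr hx
      have hℓ' : ℓ * (x₁ - x₂) = y₁ - y₂ := by rw [hℓ, div_mul_cancel₀ _ hx']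
      refine ⟨by linear_combination hℓ', mul_left_cancel₀ hx' ?_⟩
      linear_combination hc₁ - hc₂ + (2 * y₁ - ℓ * (x₁ - x₂) - (y₁ - y₂)) * hℓ'
  obtain ⟨hy₃, hz₃, hw₃, hsum⟩ := third_point_near_infinity (padicNorm_mordell_coeff p m) hρ
    hy₁ hy₂ hz₁ hz₂ hw₁ hw₂ hc₁ (by ring) line.1 line.2 rfl rfl
  have hX : (Mordell m).addX x₁ x₂ ℓ = ℓ ^ 2 - x₁ - x₂ := by
    simp [Mordell, Affine.addX]
  have hY : (Mordell m).addY x₁ x₂ y₁ ℓ =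
      -(ℓ * (ℓ ^ 2 - x₁ - x₂) + (y₁ - ℓ * x₁)) := by
    rw [Affine.addY, Affine.negAddY, hX]
    simp only [Mordell, Affine.negY]
    ring
  refine ⟨_, _, _, Affine.Point.add_some hxy, ?_⟩
  rw [← hℓ, hX, hY]
  generalize ℓ ^ 2 - x₁ - x₂ = x₃ at *
  generalize ℓ * x₃ + (y₁ - ℓ * x₁) = y₃ at *
  rw [div_neg, div_neg, padicNorm.neg, padicNorm.neg]
  refine ⟨neg_ne_zero.mpr hy₃, hz₃, hw₃, ?_⟩
  have h : -(x₃ / y₃) - (s + t) =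
      -(x₁ / y₁ + x₂ / y₂ + x₃ / y₃) + ((x₁ / y₁ - s) + (x₂ / y₂ - t)) := by ring
  rw [h]
  exact padicNorm_add_le (by rwa [padicNorm.neg]) (padicNorm_add_le hs ht)

lemma NearInfinity.nsmul {p : ℕ} [Fact p.Prime] {m : ℤ} {ρ t : ℚ} {Q : (Mordell m).Point}
    (hρ : ρ < 1) (hQ : NearInfinity p ρ Q t) (hord : ∀ k : ℕ, 0 < k → k • Q ≠ 0)
    {k : ℕ} (hk : 1 ≤ k) : NearInfinity p ρ (k • Q) (k * t) := by
  induction k, hk using Nat.le_induction with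
  | base => simpa using hQ
  | succ k _ ih =>
    have h := hord (k + 1) k.succ_pos
    rw [succ_nsmul] at h ⊢
    simpa [add_mul] using ih.add hρ hQ h

/-- A point of the Mordell curve with `p`-adically large `y` satisfies `|y|² = |x|³`. -/
lemma padicNorm_y_sq_of_one_lt_y {p : ℕ} [Fact p.Prime] {m : ℤ} {x y : ℚ}
    (h : (Mordell m).Nonsingular x y) (hy : 1 < padicNorm p y) :
    padicNorm p y ^ 2 = padicNorm p x ^ 3 := by
  have hx : x ^ 3 = y ^ 2 + -(-432 * (m : ℚ) ^ 2) := by rw [mordell_equation h]; ring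
  rw [← padicNorm_pow, ← padicNorm_pow, hx, padicNorm_add_eq_left]
  rw [padicNorm.neg, padicNorm_pow]
  exact (padicNorm_mordell_coeff p m).trans_lt (one_lt_pow₀ hy two_ne_zero)

/-- A point of the Mordell curve with `p`-adically large `x` satisfies `|y|² = |x|³`. -/
lemma padicNorm_y_sq_of_one_lt_x {p : ℕ} [Fact p.Prime] {m : ℤ} {x y : ℚ}
    (h : (Mordell m).Nonsingular x y) (hx : 1 < padicNorm p x) :
    padicNorm p y ^ 2 = padicNorm p x ^ 3 := by
  rw [← padicNorm_pow, ← padicNorm_pow, mordell_equation h, padicNorm_add_eq_left]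
  rw [padicNorm_pow]
  exact (padicNorm_mordell_coeff p m).trans_lt (one_lt_pow₀ hx three_ne_zero)

lemma padicNorm_div_sq_mul {p : ℕ} [Fact p.Prime] {x y : ℚ} (hx : x ≠ 0)
    (h : padicNorm p y ^ 2 = padicNorm p x ^ 3) :
    padicNorm p (x / y) ^ 2 * padicNorm p x = 1 := by
  have hx' : padicNorm p x ≠ 0 := padicNorm.nonzero hx
  rw [padicNorm.div, div_pow, h]
  field_simp

lemma le_padicNorm_of_one_lt {p : ℕ} [hp : Fact p.Prime] {x : ℚ} (hx : 1 < padicNorm p x) :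
    (p : ℚ) ≤ padicNorm p x := by
  have hx0 : x ≠ 0 := by
    rintro rfl
    rw [padicNorm.zero] at hx
    exact absurd hx (by norm_num)
  have hp1 : (1 : ℚ) < p := mod_cast hp.out.one_lt
  rw [padicNorm.eq_zpow_of_nonzero hx0] at hx ⊢
  have h : 0 < -padicValRat p x := (one_lt_zpow_iff_right₀ hp1).mp hx
  simpa using zpow_le_zpow_right₀ hp1.le (show (1 : ℤ) ≤ -padicValRat p x by omega)

lemma padicNorm_prime_ge {p q : ℕ} [hp : Fact p.Prime] (hq : q.Prime) :
    (p : ℚ)⁻¹ ≤ padicNorm p q := by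
  by_cases h : p = q
  · subst h
    exact padicNorm.padicNorm_p_of_prime.ge
  · have : Fact q.Prime := ⟨hq⟩
    rw [padicNorm.padicNorm_of_prime_of_ne h]
    exact inv_le_one_of_one_le₀ (mod_cast hp.out.one_le)

lemma padicNorm_xCoord_prime_nsmul {p : ℕ} [hp : Fact p.Prime] {m : ℤ} {Q : (Mordell m).Point}
    (hQ : ∀ k : ℕ, 0 < k → k • Q ≠ 0) (hx : 1 < padicNorm p (xCoord Q))
    {q : ℕ} (hq : q.Prime) :
    padicNorm p (xCoord (q • Q)) * padicNorm p q ^ 2 = padicNorm p (xCoord Q) := by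
  obtain _ | ⟨x, y, h⟩ := Q
  · exact absurd hx (by simp [xCoord])
  change 1 < padicNorm p x at hx
  change _ = padicNorm p x
  have hp1 : (1 : ℚ) < p := mod_cast hp.out.one_lt
  have hx0 : x ≠ 0 := by
    rintro rfl
    rw [padicNorm.zero] at hx
    exact absurd hx (by norm_num)
  have hsq := padicNorm_y_sq_of_one_lt_x h hx
  have hy0 : y ≠ 0 := by
    rintro rfl
    rw [padicNorm.zero] at hsq
    exact pow_ne_zero 3 (padicNorm.nonzero (p := p) hx0) (by rw [← hsq]; norm_num)
  have hz := padicNorm_div_sq_mul hx0 hsq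
  set ρ := padicNorm p (x / y) with hρd
  have hρ0 : 0 < ρ :=
    (padicNorm.nonneg _).lt_of_ne' (padicNorm.nonzero (div_ne_zero hx0 hy0))
  have hρ2 : ρ ^ 2 = (padicNorm p x)⁻¹ := eq_inv_of_mul_eq_one_left hz
  have hρ2' : ρ ^ 2 ≤ (p : ℚ)⁻¹ := by
    rw [hρ2]
    exact inv_anti₀ (by linarith) (le_padicNorm_of_one_lt hx)
  have hpinv : (p : ℚ)⁻¹ < 1 := inv_lt_one_of_one_lt₀ hp1
  have hpinv0 : (0 : ℚ) < (p : ℚ)⁻¹ := by positivity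
  have hρ : ρ < 1 := by
    refine (pow_lt_one_iff_of_nonneg hρ0.le two_ne_zero).mp (hρ2'.trans_lt hpinv)
  have hw : padicNorm p (1 / y) ≤ ρ ^ 3 := by
    refine (pow_le_pow_iff_left₀ (padicNorm.nonneg _) (by positivity) two_ne_zero).mp ?_
    rw [padicNorm.div, padicNorm.one, div_pow, hsq, one_pow, ← pow_mul, mul_comm 3 2, pow_mul,
      hρ2, inv_pow, one_div]
  have hnear : NearInfinity p ρ (.some x y h : (Mordell m).Point) (x / y) :=
    ⟨x, y, h, rfl, hy0, le_rfl, hw, by rw [sub_self, padicNorm.zero]; positivity⟩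
  obtain ⟨x', y', h', heq, hy', hz', hw', ht⟩ := hnear.nsmul hρ hQ hq.one_le
  rw [heq]
  change padicNorm p x' * _ = _
  have hqn := padicNorm_prime_ge (p := p) hq
  have hz'eq : padicNorm p (x' / y') = padicNorm p q * ρ := by
    have e : x' / y' = q * (x / y) + (x' / y' - q * (x / y)) := by ring
    rw [e, padicNorm_add_eq_left, padicNorm.mul]
    rw [padicNorm.mul, ← hρd]
    refine ht.trans_lt ?_
    calc ρ ^ 7 = (ρ ^ 2) ^ 3 * ρ := by ring
      _ ≤ ((p : ℚ)⁻¹) ^ 3 * ρ := by gcongr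
      _ < (p : ℚ)⁻¹ * ρ := by
        gcongr
        exact pow_lt_self_of_lt_one₀ hpinv0 hpinv (by norm_num)
      _ ≤ padicNorm p q * ρ := by gcongr
  have hqpos : 0 < padicNorm p q := hpinv0.trans_le hqn
  have hx'0 : x' ≠ 0 := by
    rintro rfl
    rw [zero_div, padicNorm.zero] at hz'eq
    exact (mul_pos hqpos hρ0).ne hz'eq
  have hy1 : 1 < padicNorm p y' := by
    have hy'pos : 0 < padicNorm p y' := (padicNorm.nonneg _).lt_of_ne' (padicNorm.nonzero hy')
    rw [padicNorm.div, padicNorm.one] at hw'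
    have := hw'.trans_lt (pow_lt_one₀ hρ0.le hρ three_ne_zero)
    rwa [div_lt_one hy'pos] at this
  have hfin := padicNorm_div_sq_mul hx'0 (padicNorm_y_sq_of_one_lt_y h' hy1)
  rw [hz'eq] at hfin
  have hxn : padicNorm p x = (ρ ^ 2)⁻¹ := by rw [hρ2, inv_inv]
  rw [hxn]
  field_simp
  linear_combination hfin

lemma padicNorm_xCoord_nsmul {p : ℕ} [hp : Fact p.Prime] {m : ℤ} {k : ℕ} (hk : k ≠ 0)
    {Q : (Mordell m).Point} (hQ : ∀ k : ℕ, 0 < k → k • Q ≠ 0)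
    (hx : 1 < padicNorm p (xCoord Q)) :
    padicNorm p (xCoord (k • Q)) * padicNorm p k ^ 2 = padicNorm p (xCoord Q) := by
  induction k using induction_on_primes generalizing Q with
  | zero => exact absurd rfl hk
  | one => simp
  | prime_mul q a hq ih =>
    have ha : a ≠ 0 := right_ne_zero_of_mul hk
    have hqx := padicNorm_xCoord_prime_nsmul hQ hx hq
    have hqQ : ∀ k : ℕ, 0 < k → k • q • Q ≠ 0 := fun k hk ↦ by
      rw [← mul_nsmul']
      exact hQ _ (Nat.mul_pos hk hq.pos)
    have hx' : 1 < padicNorm p (xCoord (q • Q)) := by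
      refine hx.trans_le ?_
      rw [← hqx]
      exact mul_le_of_le_one_right (padicNorm.nonneg _)
        (pow_le_one₀ (padicNorm.nonneg _) (padicNorm.of_nat q))
    rw [← hqx, ← ih ha hqQ hx', mul_nsmul, Nat.cast_mul, padicNorm.mul]
    ring

theorem ord_of_x_kernel_of_reduction
    (m : ℤ) (hm : m ≠ 0) (p : ℕ) (hp : p.Prime) (hp3 : 3 < p)
    (Q : (Mordell m).Point) (hQ : ∀ k : ℕ, 0 < k → k • Q ≠ 0)
    (hord : padicValRat p (xCoord Q) < 0)
    (k : ℕ) (hk : 1 ≤ k) :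
    padicValRat p (xCoord (k • Q)) =
      padicValRat p (xCoord Q) - 2 * (padicValNat p k : ℤ) := by
  have : Fact p.Prime := ⟨hp⟩
  have hp1 : (1 : ℚ) < p := mod_cast hp.one_lt
  have hx0 : xCoord Q ≠ 0 := fun h ↦ by simp [h] at hord
  have hx : 1 < padicNorm p (xCoord Q) := by
    rw [padicNorm.eq_zpow_of_nonzero hx0]
    exact one_lt_zpow₀ hp1 (by omega)
  have hk0 : k ≠ 0 := by omega
  have hkQ : (k : ℚ) ≠ 0 := mod_cast hk0
  have key := padicNorm_xCoord_nsmul hk0 hQ hx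
  have hx'0 : xCoord (k • Q) ≠ 0 := by
    intro h
    rw [h, padicNorm.zero, zero_mul] at key
    exact padicNorm.nonzero hx0 key.symm
  rw [← padicNorm_pow, ← padicNorm.mul,
    padicNorm.eq_zpow_of_nonzero (mul_ne_zero hx'0 (pow_ne_zero 2 hkQ)),
    padicNorm.eq_zpow_of_nonzero hx0] at key
  have hv := zpow_right_injective₀ (by linarith) hp1.ne' key
  rw [padicValRat.mul hx'0 (pow_ne_zero 2 hkQ), padicValRat.pow, padicValRat.of_nat] at hv
  rw [Nat.cast_ofNat] at hv
  linarith
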